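/- Let q = 2^h be a power of 2 and F a finite field with q elements. Let W₅ = { [[x, 0, z], [0, y, z], [z, z, z]] : x, y, z ∈ F } ⊆ Sym₃(F). Then the point-orbit distribution of W₅ is [2, 0, 2q−2, q²−q+1]: W₅ has exactly 2 rank-1 points, no rank-2 points with zero diagonal, exactly 2q−2 rank-2 points with nonzero diagonal, and exactly q²−q+1 rank-3 points. -/

import Mathlib

open Matrix

/-- A *point* of a plane `W` of `PG(5,q)` (viewed as a 3-dimensional linear subspace of the
space of symmetric `3×3` matrices): a 1-dimensional linear subspace `P ≤ W`, all of whose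
nonzero matrices satisfy the predicate `pred` (e.g. a rank condition). -/
def IsPointOf (F : Type) [Field F] (W P : Submodule F (Matrix (Fin 3) (Fin 3) F))
    (pred : Matrix (Fin 3) (Fin 3) F → Prop) : Prop :=
  P ≤ W ∧ Module.finrank F ↥P = 1 ∧ ∀ M ∈ P, M ≠ 0 → pred M

section

variable {F : Type} [Field F]

/-- The matrix with coordinates `x, y, z` in the plane of symmetric matrices
`[[x, 0, z], [0, y, z], [z, z, z]]`. -/
def planeMatrix (x y z : F) : Matrix (Fin 3) (Fin 3) F :=
  !![x, 0, z; 0, y, z; z, z, z]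

/-- Normalised representatives of the points of the plane: last nonzero coordinate, in the
order `x, y, z`, equal to one. -/
def pointRep : F × F ⊕ F ⊕ Unit → Matrix (Fin 3) (Fin 3) F
  | .inl (x, y) => planeMatrix x y 1
  | .inr (.inl x) => planeMatrix x 1 0
  | .inr (.inr _) => planeMatrix 1 0 0

theorem smul_planeMatrix (c x y z : F) :
    c • planeMatrix x y z = planeMatrix (c * x) (c * y) (c * z) := by
  ext i j
  fin_cases i <;> fin_cases j <;> simp [planeMatrix]

theorem planeMatrix_inj {x y z x' y' z' : F} :
    planeMatrix x y z = planeMatrix x' y' z' ↔ x = x' ∧ y = y' ∧ z = z' := by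
  refine ⟨fun e => ⟨?_, ?_, ?_⟩, by rintro ⟨rfl, rfl, rfl⟩; rfl⟩
  · simpa [planeMatrix] using congrFun (congrFun e 0) 0
  · simpa [planeMatrix] using congrFun (congrFun e 1) 1
  · simpa [planeMatrix] using congrFun (congrFun e 2) 2

theorem planeMatrix_zero : planeMatrix (0 : F) 0 0 = 0 := by
  ext i j
  fin_cases i <;> fin_cases j <;> simp [planeMatrix]

theorem pointRep_ne_zero (r : F × F ⊕ F ⊕ Unit) : pointRep r ≠ 0 := by
  rw [← planeMatrix_zero]
  rcases r with ⟨x, y⟩ | x | _ <;> simp [pointRep, planeMatrix_inj]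

theorem span_pointRep_injective :
    Function.Injective fun r : F × F ⊕ F ⊕ Unit => Submodule.span F {pointRep r} := by
  intro r s e
  obtain ⟨u, hu⟩ := Submodule.span_singleton_eq_span_singleton.mp e
  rw [Units.smul_def] at hu
  have hu0 := u.ne_zero
  rcases r with ⟨x, y⟩ | x | _ <;> rcases s with ⟨x', y'⟩ | x' | _ <;>
    simp only [pointRep, smul_planeMatrix, planeMatrix_inj] at hu <;> grind

theorem exists_smul_pointRep {x y z : F} (hne : planeMatrix x y z ≠ 0) :
    ∃ c : F, c ≠ 0 ∧ ∃ r, planeMatrix x y z = c • pointRep r := by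
  by_cases hz : z = 0
  · by_cases hy : y = 0
    · have hx : x ≠ 0 := by
        rintro rfl
        exact hne (by rw [hy, hz, planeMatrix_zero])
      exact ⟨x, hx, .inr (.inr ()), by simp [pointRep, smul_planeMatrix, hy, hz]⟩
    · refine ⟨y, hy, .inr (.inl (x / y)), ?_⟩
      simp [pointRep, smul_planeMatrix, hz, mul_div_cancel₀, hy]
  · refine ⟨z, hz, .inl (x / z, y / z), ?_⟩
    simp [pointRep, smul_planeMatrix, mul_div_cancel₀, hz]

/-- Points of the plane satisfying a scaling-invariant predicate are counted by their normalised
representatives. -/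
theorem card_points_eq_ncard_pointRep (W : Submodule F (Matrix (Fin 3) (Fin 3) F))
    (hW : (W : Set (Matrix (Fin 3) (Fin 3) F)) =
      {M | ∃ x y z : F, M = !![x, 0, z; 0, y, z; z, z, z]})
    (p : Matrix (Fin 3) (Fin 3) F → Prop) (hp : ∀ c : F, c ≠ 0 → ∀ M, p (c • M) ↔ p M) :
    Nat.card {P | IsPointOf F W P p} = {r | p (pointRep r)}.ncard := by
  have mem_W (M : Matrix (Fin 3) (Fin 3) F) : M ∈ W ↔ ∃ x y z : F, M = planeMatrix x y z := by
    rw [← SetLike.mem_coe, hW]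
    rfl
  rw [Nat.card_coe_set_eq, ← Set.ncard_image_of_injective _ span_pointRep_injective]
  congr 1
  ext P
  constructor
  · rintro ⟨hPW, hP, hpP⟩
    obtain ⟨M, hM, hM0⟩ := P.exists_mem_ne_zero_of_ne_bot (by rintro rfl; simp at hP)
    obtain ⟨x, y, z, rfl⟩ := (mem_W M).mp (hPW hM)
    obtain ⟨c, hc, r, hr⟩ := exists_smul_pointRep hM0
    have hrP : pointRep r ∈ P := (P.smul_mem_iff hc).mp (hr ▸ hM)
    refine ⟨r, hpP _ hrP (pointRep_ne_zero r), ?_⟩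
    have : FiniteDimensional F P := Module.finite_of_finrank_eq_succ hP
    exact Submodule.eq_of_le_of_finrank_eq ((Submodule.span_singleton_le_iff_mem _ _).mpr hrP)
      (by rw [finrank_span_singleton (pointRep_ne_zero r), hP])
  · rintro ⟨r, hr, rfl⟩
    refine ⟨(Submodule.span_singleton_le_iff_mem _ _).mpr ((mem_W _).mpr ?_),
      finrank_span_singleton (pointRep_ne_zero r), ?_⟩
    · rcases r with ⟨x, y⟩ | x | _ <;> exact ⟨_, _, _, rfl⟩
    · intro M hM hM0
      obtain ⟨c, rfl⟩ := Submodule.mem_span_singleton.mp hM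
      exact (hp c (left_ne_zero_of_smul hM0) _).mpr hr

theorem rank_smul_of_ne_zero {c : F} (hc : c ≠ 0) (M : Matrix (Fin 3) (Fin 3) F) :
    (c • M).rank = M.rank :=
  rank_smul_of_mem_nonZeroDivisors M (mem_nonZeroDivisors_of_ne_zero hc)

theorem rank_lt_of_det_eq_zero {n : ℕ} {M : Matrix (Fin n) (Fin n) F} (hM : M.det = 0) :
    M.rank < n := by
  refine lt_of_le_of_ne M.rank_le_width fun e => ?_
  have : LinearIndependent F M.col :=
    linearIndependent_iff_card_eq_finrank_span.mpr (by
      rw [Fintype.card_fin, Set.finrank, ← M.rank_eq_finrank_span_cols, e])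
  rw [linearIndependent_cols_iff_isUnit, isUnit_iff_isUnit_det, hM] at this
  exact not_isUnit_zero this

theorem det_planeMatrix_one (x y : F) :
    (planeMatrix x y 1).det = (x - 1) * (y - 1) - 1 := by
  simp [planeMatrix, det_fin_three]
  ring

theorem rank_planeMatrix_one_eq_three {x y : F} (hxy : (x - 1) * (y - 1) ≠ 1) :
    (planeMatrix x y 1).rank = 3 := by
  simpa using rank_of_det_ne_zero (A := planeMatrix x y 1)
    (by rw [det_planeMatrix_one]; exact sub_ne_zero.mpr hxy)

theorem rank_planeMatrix_one_eq_two {x y : F} (hxy : (x - 1) * (y - 1) = 1) :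
    (planeMatrix x y 1).rank = 2 := by
  have h3 : (planeMatrix x y 1).rank < 3 :=
    rank_lt_of_det_eq_zero (by rw [det_planeMatrix_one, hxy, sub_self])
  have h2 {r c : Fin 2 → Fin 3} (hd : ((planeMatrix x y 1).submatrix r c).det ≠ 0) :
      2 ≤ (planeMatrix x y 1).rank := by
    simpa [rank_of_det_ne_zero hd] using (planeMatrix x y 1).rank_submatrix_le r c
  have : 2 ≤ (planeMatrix x y 1).rank := by
    by_cases hx : x = 0
    · refine h2 (r := ![0, 2]) (c := ![0, 2]) ?_
      rw [det_fin_two]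
      simp [planeMatrix, hx]
    · refine h2 (r := ![0, 1]) (c := ![0, 2]) ?_
      rw [det_fin_two]
      simp [planeMatrix, hx]
  omega

theorem rank_planeMatrix_one (x y : F) [Decidable ((x - 1) * (y - 1) = 1)] :
    (planeMatrix x y 1).rank = if (x - 1) * (y - 1) = 1 then 2 else 3 := by
  split_ifs with hxy
  · exact rank_planeMatrix_one_eq_two hxy
  · exact rank_planeMatrix_one_eq_three hxy

theorem rank_planeMatrix_zero (x y : F) [DecidableEq F] :
    (planeMatrix x y 0).rank = (if x = 0 then 0 else 1) + if y = 0 then 0 else 1 := by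
  have : planeMatrix x y 0 = diagonal ![x, y, 0] := by
    ext i j
    fin_cases i <;> fin_cases j <;> simp [planeMatrix]
  rw [this, rank_diagonal, Fintype.card_subtype, Finset.card_filter, Fin.sum_univ_three]
  by_cases hx : x = 0 <;> by_cases hy : y = 0 <;> simp [hx, hy]

/-- The affine conic `(x - 1) (y - 1) = 1` is parametrised by the units of the field. -/
theorem conic_eq_range :
    {v : F × F | (v.1 - 1) * (v.2 - 1) = 1} =
      Set.range fun u : Fˣ => ((u : F) + 1, ((u⁻¹ : Fˣ) : F) + 1) := by
  ext ⟨x, y⟩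
  constructor
  · intro hxy
    refine ⟨Units.mkOfMulEqOne _ _ hxy, ?_⟩
    simp [Units.mkOfMulEqOne]
  · rintro ⟨u, hu⟩
    obtain ⟨rfl, rfl⟩ := Prod.mk.inj hu
    simp

theorem ncard_conic [Fintype F] :
    {v : F × F | (v.1 - 1) * (v.2 - 1) = 1}.ncard = Fintype.card F - 1 := by
  classical
  rw [conic_eq_range, ← Set.image_univ, Set.ncard_image_of_injective, Set.ncard_univ,
    Nat.card_eq_fintype_card, Fintype.card_units]
  intro u v e
  exact Units.ext (add_right_cancel (Prod.mk.inj e).1)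

end

theorem sigma5_point_orbit_distribution (h : ℕ) (hh : 0 < h)
    (F : Type) [Field F] [Fintype F] (hF : Fintype.card F = 2 ^ h)
    (W : Submodule F (Matrix (Fin 3) (Fin 3) F))
    (hW : (W : Set (Matrix (Fin 3) (Fin 3) F)) =
      {M | ∃ x y z : F, M = !![x, 0, z; 0, y, z; z, z, z]}) :
    Nat.card {P | IsPointOf F W P (fun M => M.rank = 1)} = 2 ∧
    Nat.card {P | IsPointOf F W P (fun M => M.rank = 2 ∧ ∀ i, M i i = 0)} = 0 ∧
    Nat.card {P | IsPointOf F W P (fun M => M.rank = 2 ∧ ∃ i, M i i ≠ 0)} = 2 * 2 ^ h - 2 ∧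
    Nat.card {P | IsPointOf F W P (fun M => M.rank = 3)} = (2 ^ h) ^ 2 - 2 ^ h + 1 := by
  classical
  have hq : 2 ≤ 2 ^ h := by simpa using Nat.pow_le_pow_right two_pos hh
  have hrank (n : ℕ) (c : F) (hc : c ≠ 0) (M : Matrix (Fin 3) (Fin 3) F) :
      (c • M).rank = n ↔ M.rank = n := by rw [rank_smul_of_ne_zero hc]
  have hinl (s : Set (F × F)) :
      (Sum.inl '' s : Set (F × F ⊕ F ⊕ Unit)).ncard = s.ncard :=
    Set.ncard_image_of_injective _ Sum.inl_injective
  refine ⟨?_, ?_, ?_, ?_⟩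
  · rw [card_points_eq_ncard_pointRep W hW _ (hrank 1)]
    have : {r : F × F ⊕ F ⊕ Unit | (pointRep r).rank = 1} =
        {.inr (.inl 0), .inr (.inr ())} := by
      ext r
      rcases r with ⟨x, y⟩ | x | _
      · simp [pointRep, rank_planeMatrix_one]
        split_ifs <;> simp
      · simp [pointRep, rank_planeMatrix_zero]
      · simp [pointRep, rank_planeMatrix_zero]
    rw [this, Set.ncard_pair (by simp)]
  · rw [card_points_eq_ncard_pointRep W hW _ fun c hc M => by simp [hrank 2 c hc, hc]]
    rw [Set.ncard_eq_zero, Set.eq_empty_iff_forall_notMem]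
    rintro (⟨x, y⟩ | x | _) ⟨-, hd⟩
    · simpa [pointRep, planeMatrix] using hd 2
    · simpa [pointRep, planeMatrix] using hd 1
    · simpa [pointRep, planeMatrix] using hd 0
  · rw [card_points_eq_ncard_pointRep W hW _ fun c hc M => by simp [hrank 2 c hc, hc]]
    have : {r : F × F ⊕ F ⊕ Unit | (pointRep r).rank = 2 ∧ ∃ i, pointRep r i i ≠ 0} =
        Sum.inl '' {v : F × F | (v.1 - 1) * (v.2 - 1) = 1} ∪
          (Sum.inr ∘ Sum.inl) '' {0}ᶜ := by
      ext r
      rcases r with ⟨x, y⟩ | x | _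
      · have : ∃ i, planeMatrix x y 1 i i ≠ 0 := ⟨2, by simp [planeMatrix]⟩
        simp [pointRep, rank_planeMatrix_one, this]
      · have : ∃ i, planeMatrix x 1 0 i i ≠ 0 := ⟨1, by simp [planeMatrix]⟩
        simp [pointRep, rank_planeMatrix_zero, this]
      · simp [pointRep, rank_planeMatrix_zero]
    rw [this, Set.ncard_union_eq, hinl, ncard_conic,
      Set.ncard_image_of_injective _ (Sum.inr_injective.comp Sum.inl_injective),
      Set.ncard_compl, Set.ncard_singleton, Nat.card_eq_fintype_card, hF]
    · omega
    · rw [Set.disjoint_left]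
      rintro _ ⟨v, -, rfl⟩ ⟨x, -, hx⟩
      simp at hx
  · rw [card_points_eq_ncard_pointRep W hW _ (hrank 3)]
    have : {r : F × F ⊕ F ⊕ Unit | (pointRep r).rank = 3} =
        Sum.inl '' {v : F × F | (v.1 - 1) * (v.2 - 1) = 1}ᶜ := by
      ext r
      rcases r with ⟨x, y⟩ | x | _
      · simp [pointRep, rank_planeMatrix_one]
      · simp [pointRep, rank_planeMatrix_zero]
        split_ifs <;> simp
      · simp [pointRep, rank_planeMatrix_zero]
    rw [this, hinl, Set.ncard_compl, ncard_conic, Nat.card_prod, Nat.card_eq_fintype_card, hF,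
      ← sq]
    have : 2 ^ h ≤ (2 ^ h) ^ 2 := Nat.le_self_pow two_ne_zero _
    omega
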